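/- (Reduction of energy Büchi MDPs to energy Büchi games) Let M = (Q, E, δ) be an MDP with weight function w : Q × Q → ℤ and priority function p : Q → {0,1} such that every probabilistic state q ∈ Q_P has p(q) = 1 and E(q) has exactly two elements, each with δ(q)-probability 1/2. Construct the two-player game G = (Q', E') with weight w' and priority p' as follows: Q' = Q ∪ (Q_P × {L, R}) with player-1 states Q'₁ = Q₁ ∪ (Q_P × {L}) and player-2 states Q'₂ = Q_P ∪ (Q_P × {R}); E' consists of: all (q,q') ∈ E with q ∈ Q₁ (weight w(q,q')), edges (q, (q,d)) for q ∈ Q_P and d ∈ {L,R} (weight 0), and edges ((q,d), q') for q ∈ Q_P, d ∈ {L,R}, q' ∈ E(q) (weight w(q,q')); p'(q) = p(q) for q ∈ Q, p'((q,L)) = 1, and p'((q,R)) = 0. Then for every state q₀ ∈ Q and every initial credit c₀ ∈ ℕ: there exists a strategy σ in M with P_{q₀}^σ(PosEnergy(c₀) ∩ Büchi(p⁻¹(0))) = 1 if and only if there exists a winning strategy from q₀ in G for the objective PosEnergy(c₀) ∩ Büchi(p'⁻¹(0)) (with energy computed using w'). -/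

import Mathlib

open MeasureTheory Filter
open scoped Classical ENNReal

namespace MPP

/-- A Markov decision process: states `Q`, player-1 states `Q1` (the rest are
probabilistic), edge relation `E` with every state having a successor, and a
probabilistic transition function `δ` whose support at every probabilistic state
is exactly the set of successors. -/
structure MDP (Q : Type) where
  Q1 : Set Q
  E : Q → Q → Prop
  E_nonempty : ∀ q, ∃ q', E q q'
  δ : Q → PMF Q
  δ_support : ∀ q, q ∉ Q1 → ∀ q', q' ∈ (δ q).support ↔ E q q'

/-- A strategy: given the history `h` (the states strictly before the current one)
and the current state `q`, if `q` is a player-1 state it selects a distribution on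
successors of `q`. -/
structure Strategy {Q : Type} (M : MDP Q) where
  act : List Q → Q → PMF Q
  act_support : ∀ h q, q ∈ M.Q1 → ∀ q', q' ∈ (act h q).support → M.E q q'

variable {Q : Type}

/-- One step of the history-dependent transition kernel. -/
noncomputable def MDP.step (M : MDP Q) (σ : Strategy M) (h : List Q) (q : Q) : PMF Q :=
  if q ∈ M.Q1 then σ.act h q else M.δ q

/-- Probability of traversing the finite sequence `future` starting at `q` with
past history `h`. -/
noncomputable def pathProb (M : MDP Q) (σ : Strategy M) : List Q → Q → List Q → ℝ≥0∞
  | _, _, [] => 1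
  | h, q, q' :: rest => M.step σ h q q' * pathProb M σ (h ++ [q]) q' rest

/-- `μ` is the trajectory measure (Ionescu–Tulcea) on plays of `M` under strategy
`σ`, starting at `q`: it is the (unique) probability measure on `ℕ → Q` (product
σ-algebra) giving every cylinder its product probability. -/
def IsTrajMeasure [MeasurableSpace Q] (M : MDP Q) (σ : Strategy M) (q : Q)
    (μ : Measure (ℕ → Q)) : Prop :=
  IsProbabilityMeasure μ ∧
    ∀ (n : ℕ) (f : ℕ → Q),
      μ {ρ | ∀ i ≤ n, ρ i = f i} =
        if f 0 = q then pathProb M σ [] q ((List.range n).map fun i => f (i + 1)) else 0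

/-- The set of states occurring infinitely often in a play. -/
def infSet (ρ : ℕ → Q) : Set Q := {s | ∀ N, ∃ n, N ≤ n ∧ ρ n = s}

/-- End-component: nonempty, closed under probabilistic transitions, every state has
a successor inside, and strongly connected inside. -/
def MDP.IsEndComponent (M : MDP Q) (U : Set Q) : Prop :=
  U.Nonempty ∧
    (∀ q ∈ U, q ∉ M.Q1 → (M.δ q).support ⊆ U) ∧
    (∀ q ∈ U, ∃ q' ∈ U, M.E q q') ∧
    ∀ q ∈ U, ∀ q' ∈ U, Relation.ReflTransGen (fun a b => a ∈ U ∧ b ∈ U ∧ M.E a b) q q'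

/-- Energy level of the length-`n` prefix of a play. -/
def EL (w : Q → Q → ℤ) (ρ : ℕ → Q) (n : ℕ) : ℤ :=
  ∑ i ∈ Finset.range n, w (ρ i) (ρ (i + 1))

/-- Mean payoff (liminf of averages) of a play. -/
noncomputable def MP (w : Q → Q → ℤ) (ρ : ℕ → Q) : ℝ :=
  liminf (fun n => (EL w ρ n : ℝ) / n) atTop

/-- Parity objective: the minimal priority visited infinitely often is even. -/
def ParitySet (p : Q → ℕ) : Set (ℕ → Q) := {ρ | Even (sInf (p '' infSet ρ))}

def MeanPayoffGe (w : Q → Q → ℤ) (ν : ℝ) : Set (ℕ → Q) := {ρ | ν ≤ MP w ρ}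

def MeanPayoffGt (w : Q → Q → ℤ) (ν : ℝ) : Set (ℕ → Q) := {ρ | ν < MP w ρ}

/-- Energy objective with initial credit `c₀`. -/
def PosEnergy (w : Q → Q → ℤ) (c₀ : ℕ) : Set (ℕ → Q) :=
  {ρ | ∀ n, 0 ≤ (c₀ : ℤ) + EL w ρ n}

/-- Büchi objective: some state of `B` is visited infinitely often. -/
def Buchi (B : Set Q) : Set (ℕ → Q) := {ρ | (infSet ρ ∩ B).Nonempty}

/-- Expected mean-payoff value: supremum over strategies of the expectation of the
mean payoff under the trajectory measure. -/
noncomputable def ValMP [MeasurableSpace Q] (M : MDP Q) (w : Q → Q → ℤ) (q : Q) : ℝ :=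
  sSup {x | ∃ σ : Strategy M, ∃ μ : Measure (ℕ → Q),
    IsTrajMeasure M σ q μ ∧ x = ∫ ρ, MP w ρ ∂μ}


/-- A two-player game: player-1 states `S1` (the rest belong to player 2) and an edge
relation with every state having a successor. -/
structure Game (S : Type) where
  S1 : Set S
  E : S → S → Prop
  E_nonempty : ∀ s, ∃ s', E s s'

/-- A pure player-1 strategy in a two-player game. -/
structure GStrategy {S : Type} (G : Game S) where
  move : List S → S → S
  move_ok : ∀ h s, s ∈ G.S1 → G.E s (move h s)

/-- A play consistent with a player-1 strategy: moves from player-1 states follow the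
strategy, moves from player-2 states follow arbitrary edges. -/
def GConsistent {S : Type} (G : Game S) (τ : GStrategy G) (s₀ : S) (ρ : ℕ → S) : Prop :=
  ρ 0 = s₀ ∧ ∀ i : ℕ,
    (ρ i ∈ G.S1 → ρ (i + 1) = τ.move ((List.range i).map ρ) (ρ i)) ∧
    (ρ i ∉ G.S1 → G.E (ρ i) (ρ (i + 1)))

/-- A player-1 strategy is winning from `s₀` for objective `φ` if every consistent
play from `s₀` belongs to `φ`. -/
def GWinning {S : Type} (G : Game S) (τ : GStrategy G) (s₀ : S) (φ : Set (ℕ → S)) :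
    Prop :=
  ∀ ρ : ℕ → S, GConsistent G τ s₀ ρ → ρ ∈ φ

/-- The weight function of the gadget game: `L`/`R` gadget states are encoded as
`Sum.inr (q, false)` / `Sum.inr (q, true)`. Edges into the gadget have weight `0`,
edges out of the gadget inherit the weight of the corresponding MDP edge. -/
def gadgetW (w : Q → Q → ℤ) : Q ⊕ Q × Bool → Q ⊕ Q × Bool → ℤ
  | Sum.inl q, Sum.inl q' => w q q'
  | Sum.inr (q, _), Sum.inl q' => w q q'
  | _, _ => 0

/-- The priority function of the gadget game: states of `Q` keep their priority,
`(q, L)` states have priority `1` and `(q, R)` states have priority `0`. -/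
def gadgetP (p : Q → ℕ) : Q ⊕ Q × Bool → ℕ
  | Sum.inl q => p q
  | Sum.inr (_, false) => 1
  | Sum.inr (_, true) => 0

/-! ### Basic facts -/

theorem EL_succ (w : Q → Q → ℤ) (ρ : ℕ → Q) (n : ℕ) :
    EL w ρ (n + 1) = EL w ρ n + w (ρ n) (ρ (n + 1)) := by
  simp [EL, Finset.sum_range_succ]

theorem EL_congr (w : Q → Q → ℤ) {ρ ρ' : ℕ → Q} {n : ℕ} (h : ∀ i ≤ n, ρ i = ρ' i) :
    EL w ρ n = EL w ρ' n := by
  unfold EL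
  refine Finset.sum_congr rfl fun i hi => ?_
  have := Finset.mem_range.1 hi
  rw [h i (by omega), h (i + 1) (by omega)]

theorem mem_Buchi_iff [Finite Q] (B : Set Q) (ρ : ℕ → Q) :
    ρ ∈ Buchi B ↔ ∀ N, ∃ n, N ≤ n ∧ ρ n ∈ B := by
  constructor
  · rintro ⟨s, hs, hB⟩ N
    obtain ⟨n, hn, rfl⟩ := hs N
    exact ⟨n, hn, hB⟩
  · intro h
    by_contra hne
    have h1 : ∀ s : Q, ∃ N, s ∈ B → ∀ n, N ≤ n → ρ n ≠ s := by
      intro s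
      by_contra hc
      push Not at hc
      exact hne ⟨s, fun N => (hc N).2, (hc 0).1⟩
    choose N hN using h1
    obtain ⟨K, hK⟩ := (Set.finite_range N).bddAbove
    obtain ⟨n, hn, hB⟩ := h K
    exact hN (ρ n) hB n ((hK ⟨ρ n, rfl⟩).trans hn) rfl

/-- Energy of the history `h` followed by the current state `q`. -/
def ELh (w : Q → Q → ℤ) (h : List Q) (q : Q) : ℤ :=
  EL w (fun i => (h ++ [q]).getD i q) h.length

theorem ELh_eq (w : Q → Q → ℤ) (f : ℕ → Q) (n : ℕ) :
    ELh w ((List.range n).map f) (f n) = EL w f n := by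
  unfold ELh
  rw [List.length_map, List.length_range]
  apply EL_congr
  intro i hi
  rcases hi.lt_or_eq with h | rfl
  · rw [List.getD_append _ _ _ _ (by simpa using h)]
    simp [List.getD_eq_getElem?_getD, h]
  · rw [List.getD_append_right _ _ _ _ (by simp)]
    simp

/-- Extending a finite prefix to an infinite sequence by a history dependent rule. -/
theorem exists_extension {S : Type} (F : List S → S → S) (ρ : ℕ → S) (n : ℕ) :
    ∃ ρ' : ℕ → S, (∀ i ≤ n, ρ' i = ρ i) ∧
      ∀ i, n ≤ i → ρ' (i + 1) = F ((List.range i).map ρ') (ρ' i) := by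
  let H : ℕ → List S × S := fun k => Nat.rec ((List.range n).map ρ, ρ n)
    (fun _ x => (x.1 ++ [x.2], F x.1 x.2)) k
  have Hs : ∀ k, H (k + 1) = ((H k).1 ++ [(H k).2], F (H k).1 (H k).2) := fun _ => rfl
  let ρ' : ℕ → S := fun i => if i ≤ n then ρ i else (H (i - n)).2
  have h2 : ∀ k, ρ' (n + k) = (H k).2 := by
    intro k
    cases k with
    | zero => simp [ρ', H]
    | succ k => simp [ρ']
  have h1 : ∀ k, (List.range (n + k)).map ρ' = (H k).1 := by
    intro k
    induction k with
    | zero =>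
      simp only [Nat.add_zero, H]
      apply List.map_congr_left
      intro i hi
      have := List.mem_range.1 hi
      simp only [ρ', this.le, if_true]
    | succ k ih =>
      rw [← Nat.add_assoc, List.range_succ, List.map_append, ih, Hs]
      simp [h2]
  refine ⟨ρ', fun i hi => by simp [ρ', hi], fun i hi => ?_⟩
  obtain ⟨k, rfl⟩ := Nat.exists_eq_add_of_le hi
  rw [h1, h2, Nat.add_assoc, h2, Hs]

/-! ### The combinatorial core -/

/-- The intermediate characterisation: a set `W` of winning configurations (state, credit)
with a bounded rank function and a positional choice which decreases the rank. -/
def Core (M : MDP Q) (w : Q → Q → ℤ) (p : Q → ℕ) (q₀ : Q) (c₀ : ℤ) : Prop :=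
  ∃ (W : Q → ℤ → Prop) (r : Q → ℤ → ℕ) (N : ℕ) (ch : Q → ℤ → Q),
    W q₀ c₀ ∧ (∀ q c, M.E q (ch q c)) ∧ ∀ q c, W q c →
      0 ≤ c ∧ W (ch q c) (c + w q (ch q c)) ∧
      (p q = 0 ∨ r (ch q c) (c + w q (ch q c)) < r q c) ∧
      (q ∉ M.Q1 → ∀ y, M.E q y → W y (c + w q y)) ∧ r q c ≤ N

/-- A safe cooperative step. -/
def StepOK (M : MDP Q) (w : Q → Q → ℤ) (W : Q → ℤ → Prop) (q : Q) (c : ℤ) (q' : Q) : Prop :=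
  M.E q q' ∧ W q' (c + w q q') ∧ (q ∉ M.Q1 → ∀ y, M.E q y → W y (c + w q y))

/-- `Wit n q c`: a priority-0 state can be reached by `n` safe cooperative steps. -/
inductive Wit (M : MDP Q) (w : Q → Q → ℤ) (p : Q → ℕ) (W : Q → ℤ → Prop) :
    ℕ → Q → ℤ → Prop
  | zero {q c q'} : p q = 0 → StepOK M w W q c q' → Wit M w p W 0 q c
  | succ {n q c q'} : StepOK M w W q c q' → Wit M w p W n q' (c + w q q') →
      Wit M w p W (n + 1) q c

theorem StepOK.mono {M : MDP Q} {w : Q → Q → ℤ} {W : Q → ℤ → Prop}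
    (hup : ∀ q c c', W q c → c ≤ c' → W q c') {q : Q} {c c' : ℤ} {q' : Q}
    (h : StepOK M w W q c q') (hc : c ≤ c') : StepOK M w W q c' q' :=
  ⟨h.1, hup _ _ _ h.2.1 (by omega), fun hq y hy => hup _ _ _ (h.2.2 hq y hy) (by omega)⟩

theorem Wit.mono {M : MDP Q} {w : Q → Q → ℤ} {p : Q → ℕ} {W : Q → ℤ → Prop}
    (hup : ∀ q c c', W q c → c ≤ c' → W q c') {n : ℕ} {q : Q} {c : ℤ}
    (h : Wit M w p W n q c) : ∀ c', c ≤ c' → Wit M w p W n q c' := by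
  induction h with
  | zero hp hs => exact fun c' hc => .zero hp (hs.mono hup hc)
  | succ hs _ ih => exact fun c' hc => .succ (hs.mono hup hc) (ih _ (by omega))

theorem core_of_wit [Fintype Q] (M : MDP Q) (w : Q → Q → ℤ) (p : Q → ℕ) (q₀ : Q) (c₀ : ℤ)
    (W : Q → ℤ → Prop) (h0 : W q₀ c₀) (hup : ∀ q c c', W q c → c ≤ c' → W q c')
    (hnn : ∀ q c, W q c → 0 ≤ c) (hw : ∀ q c, W q c → ∃ n, Wit M w p W n q c) :
    Core M w p q₀ c₀ := by
  let r : Q → ℤ → ℕ := fun q c => sInf {n | Wit M w p W n q c}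
  have hb : ∀ q, ∃ b, ∀ c, W q c → r q c ≤ b := by
    intro q
    by_cases he : ∃ c, W q c
    · obtain ⟨c, hc, hmin⟩ := Int.exists_least_of_bdd (P := W q) ⟨0, fun z hz => hnn q z hz⟩ he
      obtain ⟨n, hn⟩ := hw q c hc
      exact ⟨n, fun c' hc' => Nat.sInf_le (hn.mono hup c' (hmin c' hc'))⟩
    · exact ⟨0, fun c hc => absurd ⟨c, hc⟩ he⟩
  choose b hb using hb
  have hch : ∀ q c, ∃ q', M.E q q' ∧ (W q c → W q' (c + w q q') ∧
      (p q = 0 ∨ r q' (c + w q q') < r q c) ∧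
      (q ∉ M.Q1 → ∀ y, M.E q y → W y (c + w q y))) := by
    intro q c
    by_cases hW : W q c
    · have hr : Wit M w p W (r q c) q c := Nat.sInf_mem (s := {n | Wit M w p W n q c}) (hw q c hW)
      generalize hk : r q c = k at hr
      cases hr with
      | zero hp hs => exact ⟨_, hs.1, fun _ => ⟨hs.2.1, .inl hp, hs.2.2⟩⟩
      | @succ n _ _ q' hs hn =>
        refine ⟨q', hs.1, fun _ => ⟨hs.2.1, .inr ?_, hs.2.2⟩⟩
        have : r q' (c + w q q') ≤ n := Nat.sInf_le hn
        omega
    · obtain ⟨q', hq'⟩ := M.E_nonempty q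
      exact ⟨q', hq', fun h => absurd h hW⟩
  choose ch hE hch using hch
  refine ⟨W, r, ∑ q, b q, ch, h0, hE, fun q c hW => ?_⟩
  obtain ⟨h1, h2, h3⟩ := hch q c hW
  exact ⟨hnn q c hW, h1, h2, h3, (hb q c hW).trans
    (Finset.single_le_sum (f := b) (fun _ _ => Nat.zero_le _) (Finset.mem_univ q))⟩

/-! ### The game side -/

/-- Underlying MDP state of a game state. -/
def base : Q ⊕ Q × Bool → Q
  | Sum.inl q => q
  | Sum.inr (q, _) => q

/-- The structural description of the gadget game. -/
structure IsGadget (M : MDP Q) (G : Game (Q ⊕ Q × Bool)) : Prop where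
  inl_mem : ∀ q, Sum.inl q ∈ G.S1 ↔ q ∈ M.Q1
  inr_false_mem : ∀ q, Sum.inr (q, false) ∈ G.S1 ↔ q ∉ M.Q1
  inr_true_mem : ∀ q, Sum.inr (q, true) ∉ G.S1
  E_ll : ∀ q q', G.E (Sum.inl q) (Sum.inl q') ↔ q ∈ M.Q1 ∧ M.E q q'
  E_lr : ∀ q q' d, G.E (Sum.inl q) (Sum.inr (q', d)) ↔ q ∉ M.Q1 ∧ q' = q
  E_rl : ∀ q d q', G.E (Sum.inr (q, d)) (Sum.inl q') ↔ q ∉ M.Q1 ∧ M.E q q'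
  E_rr : ∀ q d q' d', G.E (Sum.inr (q, d)) (Sum.inr (q', d')) ↔ q ∈ M.Q1 ∧ q' = q ∧ d' = d

theorem core_to_game [Fintype Q] (M : MDP Q) (w : Q → Q → ℤ) (p : Q → ℕ)
    (hpP : ∀ q, q ∉ M.Q1 → p q = 1)
    (G : Game (Q ⊕ Q × Bool)) (hG : IsGadget M G) (q₀ : Q) (c₀ : ℕ)
    (hcore : Core M w p q₀ c₀) :
    ∃ τ : GStrategy G, GWinning G τ (Sum.inl q₀)
        (PosEnergy (gadgetW w) c₀ ∩ Buchi {s | gadgetP p s = 0}) := by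
  obtain ⟨W, r, N, ch, h0, hchE, hW⟩ := hcore
  let τ : GStrategy G :=
    { move := fun h s => Sum.inl (ch (base s) (c₀ + ELh (gadgetW w) h s))
      move_ok := by
        intro h s hs
        rcases s with q | ⟨q, d⟩
        · rw [hG.E_ll]
          exact ⟨(hG.inl_mem q).1 hs, hchE _ _⟩
        · rw [hG.E_rl]
          cases d with
          | false => exact ⟨(hG.inr_false_mem q).1 hs, hchE _ _⟩
          | true => exact absurd hs (hG.inr_true_mem q) }
  refine ⟨τ, fun ρ hρ => ?_⟩
  obtain ⟨hρ0, hρs⟩ := hρ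
  set e : ℕ → ℤ := fun i => c₀ + EL (gadgetW w) ρ i with he
  have hes : ∀ i, e (i + 1) = e i + gadgetW w (ρ i) (ρ (i + 1)) := by
    intro i
    simp only [he, EL_succ]
    ring
  have hmove : ∀ i, ρ i ∈ G.S1 → ρ (i + 1) = Sum.inl (ch (base (ρ i)) (e i)) := by
    intro i hi
    rw [(hρs i).1 hi]
    simp only [τ, ELh_eq, he]
  have step_l1 : ∀ i q, ρ i = Sum.inl q → q ∈ M.Q1 →
      ρ (i + 1) = Sum.inl (ch q (e i)) ∧ e (i + 1) = e i + w q (ch q (e i)) := by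
    intro i q hi hq
    have h1 := hmove i (by rw [hi]; exact (hG.inl_mem q).2 hq)
    rw [hi] at h1
    refine ⟨h1, ?_⟩
    rw [hes, hi, h1]
    rfl
  have step_lp : ∀ i q, ρ i = Sum.inl q → q ∉ M.Q1 →
      ∃ d, ρ (i + 1) = Sum.inr (q, d) ∧ e (i + 1) = e i := by
    intro i q hi hq
    have h1 := (hρs i).2 (by rw [hi, hG.inl_mem]; exact hq)
    have h2 := hes i
    rcases hn : ρ (i + 1) with q' | ⟨q', d⟩
    · rw [hi, hn, hG.E_ll] at h1
      exact absurd h1.1 hq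
    · rw [hi, hn, hG.E_lr] at h1
      rw [hi, hn] at h2
      refine ⟨d, by rw [h1.2], ?_⟩
      simpa [gadgetW] using h2
  have step_rf : ∀ i q, ρ i = Sum.inr (q, false) → q ∉ M.Q1 →
      ρ (i + 1) = Sum.inl (ch q (e i)) ∧ e (i + 1) = e i + w q (ch q (e i)) := by
    intro i q hi hq
    have h1 := hmove i (by rw [hi]; exact (hG.inr_false_mem q).2 hq)
    rw [hi] at h1
    refine ⟨h1, ?_⟩
    rw [hes, hi, h1]
    rfl
  have step_rt : ∀ i q, ρ i = Sum.inr (q, true) → q ∉ M.Q1 →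
      ∃ y, M.E q y ∧ ρ (i + 1) = Sum.inl y ∧ e (i + 1) = e i + w q y := by
    intro i q hi hq
    have h1 := (hρs i).2 (by rw [hi]; exact hG.inr_true_mem q)
    have h2 := hes i
    rcases hn : ρ (i + 1) with q' | ⟨q', d⟩
    · rw [hi, hn, hG.E_rl] at h1
      rw [hi, hn] at h2
      exact ⟨q', h1.2, rfl, h2⟩
    · rw [hi, hn, hG.E_rr] at h1
      exact absurd h1.1 hq
  have inv : ∀ i, W (base (ρ i)) (e i) ∧ ∀ q d, ρ i = Sum.inr (q, d) → q ∉ M.Q1 := by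
    intro i
    induction i with
    | zero =>
      rw [hρ0]
      refine ⟨?_, fun q d h => by simp at h⟩
      simpa [he, EL, base] using h0
    | succ i ih =>
      obtain ⟨ih1, ih2⟩ := ih
      rcases hi : ρ i with q | ⟨q, d⟩
      · rw [hi] at ih1
        by_cases hq : q ∈ M.Q1
        · obtain ⟨h1, h2⟩ := step_l1 i q hi hq
          rw [h1, h2]
          exact ⟨(hW _ _ ih1).2.1, fun q d h => by simp at h⟩
        · obtain ⟨d, h1, h2⟩ := step_lp i q hi hq
          rw [h1, h2]
          refine ⟨ih1, fun q' d' h => ?_⟩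
          simp only [Sum.inr.injEq, Prod.mk.injEq] at h
          rw [← h.1]
          exact hq
      · have hq := ih2 q d hi
        rw [hi] at ih1
        cases d with
        | false =>
          obtain ⟨h1, h2⟩ := step_rf i q hi hq
          rw [h1, h2]
          exact ⟨(hW _ _ ih1).2.1, fun q d h => by simp at h⟩
        | true =>
          obtain ⟨y, hy, h1, h2⟩ := step_rt i q hi hq
          rw [h1, h2]
          exact ⟨(hW _ _ ih1).2.2.2.1 hq y hy, fun q d h => by simp at h⟩
  refine ⟨fun n => (hW _ _ (inv n).1).1, ?_⟩
  rw [mem_Buchi_iff]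
  intro K
  by_contra hK
  push Not at hK
  simp only [Set.mem_ofPred_eq] at hK
  -- infinite descent
  have desc : ∀ m : ℕ, ∀ i, K ≤ i →
      2 * r (base (ρ i)) (e i) + (if (ρ i).isLeft then 1 else 0) = m → False := by
    intro m
    induction m using Nat.strong_induction_on with
    | _ m ih =>
      intro i hKi hm
      have hpi := hK i hKi
      have hWi := (inv i).1
      have hri := (inv i).2
      rcases hi : ρ i with q | ⟨q, d⟩
      · rw [hi] at hpi hWi hm
        by_cases hq : q ∈ M.Q1
        · obtain ⟨h1, h2⟩ := step_l1 i q hi hq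
          refine ih _ ?_ (i + 1) (by omega) rfl
          have h3 := (hW _ _ hWi).2.2.1.resolve_left hpi
          rw [h1, h2]
          simp only [base, Sum.isLeft_inl, if_true] at hm h3 ⊢
          omega
        · obtain ⟨d, h1, h2⟩ := step_lp i q hi hq
          refine ih _ ?_ (i + 1) (by omega) rfl
          rw [h1, h2]
          simp only [base, Sum.isLeft_inl, Sum.isLeft_inr, if_true] at hm ⊢
          simp
          omega
      · have hq := hri q d hi
        rw [hi] at hpi hWi hm
        cases d with
        | false =>
          obtain ⟨h1, h2⟩ := step_rf i q hi hq
          refine ih _ ?_ (i + 1) (by omega) rfl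
          have h3 := (hW _ _ hWi).2.2.1.resolve_left (by simp [base, hpP q hq])
          rw [h1, h2]
          simp [base] at hm h3 ⊢
          omega
        | true => exact hpi rfl
  exact desc _ K le_rfl rfl

/-- Prefix-consistency up to time `n`. -/
def PC {S : Type} (G : Game S) (τ : GStrategy G) (s₀ : S) (ρ : ℕ → S) (n : ℕ) : Prop :=
  ρ 0 = s₀ ∧ ∀ i < n,
    (ρ i ∈ G.S1 → ρ (i + 1) = τ.move ((List.range i).map ρ) (ρ i)) ∧
    (ρ i ∉ G.S1 → G.E (ρ i) (ρ (i + 1)))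

theorem map_range_congr {S : Type} {ρ ρ' : ℕ → S} {n : ℕ} (h : ∀ i < n, ρ i = ρ' i) :
    (List.range n).map ρ = (List.range n).map ρ' :=
  List.map_congr_left fun i hi => h i (List.mem_range.1 hi)

theorem PC.extend {S : Type} {G : Game S} {τ : GStrategy G} {s₀ : S} {ρ : ℕ → S} {n : ℕ}
    (h : PC G τ s₀ ρ n) (g : S → S) (hg : ∀ s, s ∉ G.S1 → G.E s (g s)) :
    ∃ ρ', GConsistent G τ s₀ ρ' ∧ (∀ i ≤ n, ρ' i = ρ i) ∧
      ∀ i, n ≤ i → ρ' i ∉ G.S1 → ρ' (i + 1) = g (ρ' i) := by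
  obtain ⟨ρ', h1, h2⟩ := exists_extension
    (fun h s => if s ∈ G.S1 then τ.move h s else g s) ρ n
  refine ⟨ρ', ⟨?_, fun i => ?_⟩, h1, fun i hi hs => ?_⟩
  · rw [h1 0 (Nat.zero_le _), h.1]
  · by_cases hi : i < n
    · rw [h1 i hi.le, h1 (i + 1) hi,
        map_range_congr (ρ := ρ') (ρ' := ρ) fun j hj => h1 j (by omega)]
      exact h.2 i hi
    · rw [h2 i (by omega)]
      refine ⟨fun hs => ?_, fun hs => ?_⟩
      · rw [if_pos hs]
      · rw [if_neg hs]
        exact hg _ hs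
  · rw [h2 i hi, if_neg hs]

theorem PC.snoc {S : Type} {G : Game S} {τ : GStrategy G} {s₀ : S} {ρ : ℕ → S} {n : ℕ}
    (h : PC G τ s₀ ρ n) (hn : ρ n ∉ G.S1) (s : S) (hs : G.E (ρ n) s) :
    PC G τ s₀ (Function.update ρ (n + 1) s) (n + 1) := by
  have h1 : ∀ i ≤ n, Function.update ρ (n + 1) s i = ρ i := fun i hi =>
    Function.update_of_ne (by omega) _ _
  refine ⟨by rw [h1 0 (Nat.zero_le _), h.1], fun i hi => ?_⟩
  rw [h1 i (by omega),
    map_range_congr (ρ := Function.update ρ (n + 1) s) (ρ' := ρ) fun j hj => h1 j (by omega)]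
  by_cases hi' : i < n
  · rw [h1 (i + 1) (by omega)]
    exact h.2 i hi'
  · obtain rfl : i = n := by omega
    rw [Function.update_self]
    exact ⟨fun h => absurd h hn, fun _ => hs⟩

theorem game_to_core [Fintype Q] (M : MDP Q) (w : Q → Q → ℤ) (p : Q → ℕ)
    (G : Game (Q ⊕ Q × Bool)) (hG : IsGadget M G) (q₀ : Q) (c₀ : ℕ)
    (hgame : ∃ τ : GStrategy G, GWinning G τ (Sum.inl q₀)
        (PosEnergy (gadgetW w) c₀ ∩ Buchi {s | gadgetP p s = 0})) :
    Core M w p q₀ c₀ := by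
  obtain ⟨τ, hτ⟩ := hgame
  let W : Q → ℤ → Prop := fun q c => ∃ ρ n, PC G τ (Sum.inl q₀) ρ n ∧ ρ n = Sum.inl q ∧
    c₀ + EL (gadgetW w) ρ n ≤ c
  -- the `all L` behaviour of player 2
  have hg : ∀ s, ∃ s', s ∉ G.S1 → G.E s s' ∧ ∀ q, s = Sum.inl q → s' = Sum.inr (q, false) := by
    intro s
    rcases s with q | ⟨q, d⟩
    · refine ⟨Sum.inr (q, false), fun h => ⟨?_, ?_⟩⟩
      · rw [hG.E_lr]
        exact ⟨fun hq => h ((hG.inl_mem q).2 hq), rfl⟩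
      · rintro q' h'
        rw [Sum.inl.inj h']
    · obtain ⟨s', hs'⟩ := G.E_nonempty (Sum.inr (q, d))
      exact ⟨s', fun _ => ⟨hs', fun q' h' => by simp at h'⟩⟩
  choose g hg using hg
  refine core_of_wit M w p q₀ c₀ W ?_ ?_ ?_ ?_
  · exact ⟨fun _ => Sum.inl q₀, 0, ⟨rfl, fun i hi => by omega⟩, rfl, by simp [EL]⟩
  · rintro q c c' ⟨ρ, n, h1, h2, h3⟩ hc
    exact ⟨ρ, n, h1, h2, h3.trans hc⟩
  · rintro q c ⟨ρ, n, h1, h2, h3⟩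
    obtain ⟨ρ', h4, h5, -⟩ := h1.extend g fun s hs => (hg s hs).1
    have := (hτ ρ' h4).1 n
    rw [EL_congr _ h5] at this
    exact this.trans h3
  · rintro q c ⟨ρ₀, n, h1, h2, h3⟩
    obtain ⟨ρ, hc, h5, hL⟩ := h1.extend g fun s hs => (hg s hs).1
    rw [← EL_congr _ h5] at h3
    rw [← h5 n le_rfl] at h2
    have hB := (hτ ρ hc).2
    rw [mem_Buchi_iff] at hB
    obtain ⟨m, hnm, hm⟩ := hB n
    have hpc : ∀ i, PC G τ (Sum.inl q₀) ρ i := fun i => ⟨hc.1, fun j _ => hc.2 j⟩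
    clear h5 h1
    -- moves along the play
    have key : ∀ i q, n ≤ i → ρ i = Sum.inl q → ∀ c : ℤ, c₀ + EL (gadgetW w) ρ i ≤ c →
        ∃ q' j, StepOK M w W q c q' ∧ ρ (i + j + 1) = Sum.inl q' ∧
          c₀ + EL (gadgetW w) ρ (i + j + 1) ≤ c + w q q' ∧
          (j = 0 ∨ j = 1 ∧ ρ (i + 1) = Sum.inr (q, false)) := by
      intro i q hi hq c hec
      by_cases hq1 : q ∈ M.Q1
      · have hs1 : ρ i ∈ G.S1 := by rw [hq, hG.inl_mem]; exact hq1
        have hmv := (hc.2 i).1 hs1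
        have hE := τ.move_ok ((List.range i).map ρ) (ρ i) hs1
        rw [← hmv, hq] at hE
        rcases hn : ρ (i + 1) with q' | ⟨q', d⟩
        · rw [hn, hG.E_ll] at hE
          have hen : c₀ + EL (gadgetW w) ρ (i + 1) ≤ c + w q q' := by
            rw [EL_succ, hq, hn]
            simp only [gadgetW]
            omega
          exact ⟨q', 0, ⟨hE.2, ⟨ρ, i + 1, hpc _, hn, hen⟩, fun h => absurd hq1 h⟩,
            hn, hen, .inl rfl⟩
        · rw [hn, hG.E_lr] at hE
          exact absurd hq1 hE.1
      · have hs1 : ρ i ∉ G.S1 := by rw [hq, hG.inl_mem]; exact hq1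
        have hn1 : ρ (i + 1) = Sum.inr (q, false) := by
          rw [hL i hi hs1]
          exact (hg _ hs1).2 q hq
        have hs2 : ρ (i + 1) ∈ G.S1 := by rw [hn1, hG.inr_false_mem]; exact hq1
        have hmv := (hc.2 (i + 1)).1 hs2
        have hE := τ.move_ok ((List.range (i + 1)).map ρ) (ρ (i + 1)) hs2
        rw [← hmv, hn1] at hE
        rcases hn : ρ (i + 1 + 1) with q' | ⟨q', d⟩
        · rw [hn, hG.E_rl] at hE
          have hen : c₀ + EL (gadgetW w) ρ (i + 1 + 1) ≤ c + w q q' := by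
            rw [EL_succ, EL_succ, hq, hn1, hn]
            simp only [gadgetW]
            omega
          refine ⟨q', 1, ⟨hE.2, ⟨ρ, i + 1 + 1, hpc _, hn, hen⟩, fun _ y hy => ?_⟩,
            hn, hen, .inr ⟨rfl, hn1⟩⟩
          have e1 := (hpc i).snoc hs1 (Sum.inr (q, true)) (by rw [hq, hG.E_lr]; exact ⟨hq1, rfl⟩)
          have e2 := e1.snoc (by rw [Function.update_self]; exact hG.inr_true_mem q) (Sum.inl y)
            (by rw [Function.update_self, hG.E_rl]; exact ⟨hq1, hy⟩)
          refine ⟨_, _, e2, Function.update_self .., ?_⟩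
          rw [EL_succ, EL_succ, EL_congr (ρ' := ρ) _ (fun j hj => by
            rw [Function.update_of_ne (by omega), Function.update_of_ne (by omega)])]
          have a1 : Function.update (Function.update ρ (i + 1) (Sum.inr (q, true))) (i + 1 + 1)
              (Sum.inl y) i = Sum.inl q := by
            rw [Function.update_of_ne (by omega), Function.update_of_ne (by omega), hq]
          have a2 : Function.update (Function.update ρ (i + 1) (Sum.inr (q, true))) (i + 1 + 1)
              (Sum.inl y) (i + 1) = Sum.inr (q, true) := by
            rw [Function.update_of_ne (by omega), Function.update_self]
          rw [a1, a2, Function.update_self]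
          simp only [gadgetW]
          omega
        · rw [hn, hG.E_rr] at hE
          exact absurd hE.1 hq1
    have main : ∀ k i q, n ≤ i → i + k = m → ρ i = Sum.inl q → ∀ c : ℤ,
        c₀ + EL (gadgetW w) ρ i ≤ c → ∃ l, Wit M w p W l q c := by
      intro k
      induction k using Nat.strong_induction_on with
      | _ k ih =>
        intro i q hni hik hq c hec
        obtain ⟨q', j, hs, hq', hec', hj⟩ := key i q hni hq c hec
        by_cases hp0 : p q = 0
        · exact ⟨0, .zero hp0 hs⟩
        · have hk : j + 1 ≤ k := by
            by_contra hlt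
            rcases hj with rfl | ⟨rfl, hr⟩
            · obtain rfl : i = m := by omega
              rw [hq] at hm
              exact hp0 hm
            · obtain rfl | rfl : m = i ∨ m = i + 1 := by omega
              · rw [hq] at hm
                exact hp0 hm
              · rw [hr] at hm
                simp [gadgetP] at hm
          obtain ⟨l, hl⟩ := ih (k - (j + 1)) (by omega) (i + j + 1) q' (by omega) (by omega)
            hq' _ hec'
          exact ⟨l + 1, .succ hs hl⟩
    exact main (m - n) n q le_rfl (by omega) h2 c h3

/-! ### Trajectory measures -/

/-- Cylinder of plays agreeing with `f` up to time `n`. -/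
def cyl (f : ℕ → Q) (n : ℕ) : Set (ℕ → Q) := {ρ | ∀ i ≤ n, ρ i = f i}

theorem pathProb_snoc (M : MDP Q) (σ : Strategy M) (n : ℕ) : ∀ (h : List Q) (f : ℕ → Q),
    pathProb M σ h (f 0) ((List.range (n + 1)).map fun i => f (i + 1)) =
      pathProb M σ h (f 0) ((List.range n).map fun i => f (i + 1)) *
        M.step σ (h ++ (List.range n).map f) (f n) (f (n + 1)) := by
  induction n with
  | zero => intro h f; simp [pathProb]
  | succ n ih =>
    intro h f
    have e := ih (h ++ [f 0]) (fun i => f (i + 1))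
    have r1 : ∀ k, ∀ g : ℕ → Q, (List.range (k + 1)).map g =
        g 0 :: (List.range k).map (fun i => g (i + 1)) := by
      intro k g
      rw [List.range_succ_eq_map, List.map_cons, List.map_map]
      rfl
    rw [r1 (n + 1), r1 n (fun i => f (i + 1)), r1 n f]
    simp only [pathProb]
    simp only [Nat.zero_add] at e ⊢
    rw [e, mul_assoc]
    simp only [List.append_assoc, List.singleton_append]

theorem cyl_zero [MeasurableSpace Q] {M : MDP Q} {σ : Strategy M} {q : Q}
    {μ : Measure (ℕ → Q)} (hμ : IsTrajMeasure M σ q μ) (f : ℕ → Q) :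
    μ (cyl f 0) = if f 0 = q then 1 else 0 := by
  have := hμ.2 0 f
  simpa [cyl, pathProb] using this

theorem cyl_succ [MeasurableSpace Q] {M : MDP Q} {σ : Strategy M} {q : Q}
    {μ : Measure (ℕ → Q)} (hμ : IsTrajMeasure M σ q μ) (f : ℕ → Q) (n : ℕ) :
    μ (cyl f (n + 1)) =
      μ (cyl f n) * M.step σ ((List.range n).map f) (f n) (f (n + 1)) := by
  unfold cyl
  rw [hμ.2, hμ.2]
  split_ifs with h
  · subst h
    have := pathProb_snoc M σ n [] f
    simpa using this
  · simp

theorem measurable_cyl [MeasurableSpace Q] [MeasurableSingletonClass Q] (f : ℕ → Q) (n : ℕ) :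
    MeasurableSet (cyl f n) := by
  have : cyl f n = ⋂ i, ⋂ (_ : i ≤ n), (fun ρ : ℕ → Q => ρ i) ⁻¹' {f i} := by
    ext ρ; simp [cyl]
  rw [this]
  exact MeasurableSet.iInter fun i => MeasurableSet.iInter fun _ =>
    (measurable_pi_apply i) (measurableSet_singleton _)

theorem exists_traj [Fintype Q] [MeasurableSpace Q] [MeasurableSingletonClass Q]
    (M : MDP Q) (σ : Strategy M) (q : Q) : ∃ μ, IsTrajMeasure M σ q μ := by
  let ext : ∀ n : ℕ, ((i : Finset.Iic n) → Q) → ℕ → Q := fun n x i =>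
    if h : i ≤ n then x ⟨i, Finset.mem_Iic.2 h⟩ else q
  let κ : (n : ℕ) → ProbabilityTheory.Kernel ((i : Finset.Iic n) → Q) Q := fun n =>
    { toFun := fun x => (M.step σ ((List.range n).map (ext n x)) (ext n x n)).toMeasure
      measurable' := Measurable.of_discrete }
  have hκ : ∀ n, ProbabilityTheory.IsMarkovKernel (κ n) := fun n =>
    ⟨fun x => PMF.toMeasure.isProbabilityMeasure _⟩
  let μ : Measure (ℕ → Q) :=
    ProbabilityTheory.Kernel.trajMeasure (X := fun _ => Q) (Measure.dirac q) κ
  have hp : IsProbabilityMeasure μ := by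
    dsimp only [μ]; infer_instance
  have hs : ∀ f n, μ (cyl f (n + 1)) =
      μ (cyl f n) * M.step σ ((List.range n).map f) (f n) (f (n + 1)) := by
    intro f n
    have key := ProbabilityTheory.Kernel.map_frestrictLe_trajMeasure_compProd_eq_map_trajMeasure
      (X := fun _ => Q) (μ₀ := Measure.dirac q) (κ := κ) (a := n)
    have k2 := congrArg (fun ν => ν ({Preorder.frestrictLe n f} ×ˢ {f (n + 1)})) key
    beta_reduce at k2
    have hm : Measurable (fun x : ℕ → Q =>
      ((Preorder.frestrictLe (π := fun _ => Q) n x), x (n + 1))) :=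
      (Preorder.measurable_frestrictLe n).prodMk (measurable_pi_apply _)
    have s1 : (fun x : ℕ → Q => ((Preorder.frestrictLe (π := fun _ => Q) n x), x (n + 1))) ⁻¹'
        ({Preorder.frestrictLe n f} ×ˢ {f (n + 1)}) = cyl f (n + 1) := by
      ext ρ
      simp only [Set.mem_preimage, Set.mem_prod, Set.mem_singleton_iff, cyl, funext_iff,
        Preorder.frestrictLe_apply, Subtype.forall, Finset.mem_Iic]
      constructor
      · rintro ⟨h1, h2⟩ i hi
        rcases Nat.le_succ_iff.1 hi with h | rfl
        · exact h1 i h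
        · exact h2
      · intro h
        exact ⟨fun i hi => h i (by omega), h _ le_rfl⟩
    have s2 : Preorder.frestrictLe (π := fun _ => Q) n ⁻¹' {Preorder.frestrictLe n f} =
        cyl f n := by
      ext ρ
      simp [cyl, funext_iff]
    rw [Measure.map_apply hm (by measurability), s1,
      Measure.compProd_apply_prod (measurableSet_singleton _) (measurableSet_singleton _),
      lintegral_singleton, Measure.map_apply (Preorder.measurable_frestrictLe n)
        (measurableSet_singleton _), s2] at k2
    have hx : ∀ i ≤ n, ext n (Preorder.frestrictLe n f) i = f i := by
      intro i hi
      simp [ext, hi]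
    have k3 : κ n (Preorder.frestrictLe n f) {f (n + 1)} =
        M.step σ ((List.range n).map f) (f n) (f (n + 1)) := by
      change (M.step σ ((List.range n).map (ext n (Preorder.frestrictLe n f)))
        (ext n (Preorder.frestrictLe n f) n)).toMeasure {f (n + 1)} = _
      rw [PMF.toMeasure_apply_singleton _ _ (measurableSet_singleton _), hx n le_rfl,
        map_range_congr (ρ' := f) fun i hi => hx i hi.le]
    rw [k3, mul_comm] at k2
    exact k2.symm
  have h0 : ∀ f, μ (cyl f 0) = if f 0 = q then 1 else 0 := by
    intro f
    have s2 : Preorder.frestrictLe (π := fun _ => Q) 0 ⁻¹' {Preorder.frestrictLe 0 f} =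
        cyl f 0 := by
      ext ρ
      simp [cyl, funext_iff]
    rw [← s2, ← Measure.map_apply (Preorder.measurable_frestrictLe 0)
      (measurableSet_singleton _)]
    have h1 : μ.map (Preorder.frestrictLe (π := fun _ => Q) 0) =
        Measure.dirac ((MeasurableEquiv.piUnique (fun _ : Finset.Iic 0 => Q)).symm q) := by
      dsimp only [μ]
      rw [ProbabilityTheory.Kernel.trajMeasure,
        Measure.map_comp _ _ (Preorder.measurable_frestrictLe 0),
        ProbabilityTheory.Kernel.traj_map_frestrictLe,
        ProbabilityTheory.Kernel.partialTraj_self, Measure.id_comp]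
      exact Measure.map_dirac' (MeasurableEquiv.measurable _) _
    rw [h1, Measure.dirac_apply' _ (measurableSet_singleton _)]
    by_cases hf : f 0 = q
    · rw [if_pos hf, Set.indicator_of_mem]
      · rfl
      · rw [Set.mem_singleton_iff]
        funext i
        have hi : (i : ℕ) = 0 := Nat.le_zero.1 (Finset.mem_Iic.1 i.2)
        change q = f i
        rw [hi, hf]
    · rw [if_neg hf, Set.indicator_of_notMem]
      rw [Set.mem_singleton_iff]
      intro h
      exact hf (congrFun h ⟨0, Finset.mem_Iic.2 le_rfl⟩).symm
  refine ⟨μ, hp, fun n f => ?_⟩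
  change μ (cyl f n) = _
  induction n with
  | zero => rw [h0]; simp [pathProb]
  | succ n ih =>
    rw [hs, ih]
    split_ifs with h
    · subst h
      rw [pathProb_snoc, List.nil_append]
    · simp

/-- Arbitrary extension of a finite tuple to a sequence. -/
def extf (q : Q) (n : ℕ) (x : Fin (n + 1) → Q) : ℕ → Q := fun i =>
  if h : i < n + 1 then x ⟨i, h⟩ else q

theorem mem_cyl_extf (q : Q) (n : ℕ) (x : Fin (n + 1) → Q) (ρ : ℕ → Q) :
    ρ ∈ cyl (extf q n x) n ↔ (fun i : Fin (n + 1) => ρ i) = x := by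
  rw [funext_iff]
  constructor
  · intro h i
    have := h i (by omega)
    simpa [extf, Nat.le_of_lt_succ i.2] using this
  · intro h i hi
    have := h ⟨i, by omega⟩
    simpa [extf, Nat.lt_succ_of_le hi] using this

theorem cyl_congr {f g : ℕ → Q} {n : ℕ} (h : ∀ i ≤ n, f i = g i) : cyl f n = cyl g n := by
  ext ρ
  exact ⟨fun hρ i hi => (hρ i hi).trans (h i hi), fun hρ i hi => (hρ i hi).trans (h i hi).symm⟩

theorem sum_cyl [Fintype Q] [MeasurableSpace Q] [MeasurableSingletonClass Q]
    (μ : Measure (ℕ → Q)) (q : Q) (n : ℕ) (A : Set (ℕ → Q)) :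
    μ A = ∑ x : Fin (n + 1) → Q, μ (cyl (extf q n x) n ∩ A) := by
  have h1 := sum_measure_preimage_singleton (μ := μ.restrict A)
    (Finset.univ : Finset (Fin (n + 1) → Q)) (f := fun (ρ : ℕ → Q) (i : Fin (n + 1)) => ρ i)
    (fun y _ => (measurable_pi_lambda _ fun i => measurable_pi_apply _)
      (measurableSet_singleton y))
  simp only [Finset.coe_univ, Set.preimage_univ, Measure.restrict_apply_univ] at h1
  rw [← h1]
  refine Finset.sum_congr rfl fun x _ => ?_
  have : (fun (ρ : ℕ → Q) (i : Fin (n + 1)) => ρ i) ⁻¹' {x} = cyl (extf q n x) n := by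
    ext ρ
    rw [mem_cyl_extf]
    rfl
  rw [this, Measure.restrict_apply (measurable_cyl _ _)]

theorem ae_pos [Fintype Q] [MeasurableSpace Q] [MeasurableSingletonClass Q]
    (μ : Measure (ℕ → Q)) (q : Q) : ∀ᵐ ρ ∂μ, ∀ n, μ (cyl ρ n) ≠ 0 := by
  rw [ae_all_iff]
  intro n
  rw [ae_iff, sum_cyl μ q n]
  refine Finset.sum_eq_zero fun x _ => ?_
  by_cases hx : μ (cyl (extf q n x) n) = 0
  · exact measure_mono_null Set.inter_subset_left hx
  · have : cyl (extf q n x) n ∩ {a | ¬ μ (cyl a n) ≠ 0} = ∅ := by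
      ext ρ
      simp only [Set.mem_inter_iff, Set.mem_empty_iff_false, iff_false, not_and]
      intro h1 h2
      apply h2
      rw [cyl_congr h1]
      exact hx
    rw [this, measure_empty]

theorem E_of_step {M : MDP Q} {σ : Strategy M} {h : List Q} {q q' : Q}
    (hs : M.step σ h q q' ≠ 0) : M.E q q' := by
  unfold MDP.step at hs
  split_ifs at hs with hq
  · exact σ.act_support h q hq q' ((PMF.mem_support_iff _ _).2 hs)
  · exact (M.δ_support q hq q').1 ((PMF.mem_support_iff _ _).2 hs)

theorem mdp_to_core [Fintype Q] [MeasurableSpace Q] [MeasurableSingletonClass Q]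
    (M : MDP Q) (w : Q → Q → ℤ) (p : Q → ℕ) (q₀ : Q) (c₀ : ℕ)
    (σ : Strategy M) (μ : Measure (ℕ → Q)) (hμ : IsTrajMeasure M σ q₀ μ)
    (h1 : μ (PosEnergy w c₀ ∩ Buchi {q | p q = 0}) = 1) : Core M w p q₀ c₀ := by
  have hprob : IsProbabilityMeasure μ := hμ.1
  have good : ∀ f n, μ (cyl f n) ≠ 0 → ∃ ρ, (∀ i ≤ n, ρ i = f i) ∧
      ρ ∈ PosEnergy w c₀ ∩ Buchi {q | p q = 0} ∧ ∀ m, μ (cyl ρ m) ≠ 0 := by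
    intro f n hf
    by_contra hc
    push Not at hc
    have hsub : PosEnergy w c₀ ∩ Buchi {q | p q = 0} ⊆
        (cyl f n)ᶜ ∪ {ρ | ¬ ∀ m, μ (cyl ρ m) ≠ 0} := by
      intro ρ hρ
      by_cases hρc : ρ ∈ cyl f n
      · right
        obtain ⟨m, hm⟩ := hc ρ hρc hρ
        exact fun h => h m hm
      · exact Or.inl hρc
    have h2 := (measure_mono (μ := μ) hsub).trans (measure_union_le _ _)
    rw [h1, ae_iff.1 (ae_pos μ q₀), add_zero, prob_compl_eq_one_sub (measurable_cyl f n)] at h2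
    exact absurd h2 (not_le.2 (ENNReal.sub_lt_self ENNReal.one_ne_top one_ne_zero hf))
  let W : Q → ℤ → Prop := fun q c => ∃ f n, μ (cyl f n) ≠ 0 ∧ f n = q ∧ c₀ + EL w f n ≤ c
  refine core_of_wit M w p q₀ c₀ W ?_ ?_ ?_ ?_
  · refine ⟨fun _ => q₀, 0, ?_, rfl, by simp [EL]⟩
    rw [cyl_zero hμ]
    simp
  · rintro q c c' ⟨f, n, h1, h2, h3⟩ hc
    exact ⟨f, n, h1, h2, h3.trans hc⟩
  · rintro q c ⟨f, n, h1, h2, h3⟩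
    obtain ⟨ρ, h4, h5, -⟩ := good f n h1
    have := h5.1 n
    rw [EL_congr w h4] at this
    exact this.trans h3
  · rintro q c ⟨f, n, h1, h2, h3⟩
    obtain ⟨ρ, h4, h5, hpos⟩ := good f n h1
    rw [← EL_congr w h4] at h3
    rw [← h4 n le_rfl] at h2
    obtain ⟨m, hnm, hm⟩ := (mem_Buchi_iff _ _).1 h5.2 n
    have key : ∀ i (c : ℤ), c₀ + EL w ρ i ≤ c → StepOK M w W (ρ i) c (ρ (i + 1)) := by
      intro i c hec
      have hs := hpos (i + 1)
      rw [cyl_succ hμ] at hs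
      refine ⟨E_of_step (right_ne_zero_of_mul hs), ⟨ρ, i + 1, hpos _, rfl, ?_⟩, fun hq y hy => ?_⟩
      · rw [EL_succ]
        omega
      · have hag : ∀ j ≤ i, Function.update ρ (i + 1) y j = ρ j := fun j hj =>
          Function.update_of_ne (by omega) _ _
        refine ⟨Function.update ρ (i + 1) y, i + 1, ?_, Function.update_self .., ?_⟩
        · rw [cyl_succ hμ, cyl_congr hag, hag i le_rfl, Function.update_self, MDP.step, if_neg hq]
          exact mul_ne_zero (hpos i) ((PMF.mem_support_iff _ _).1 ((M.δ_support _ hq y).2 hy))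
        · rw [EL_succ, EL_congr w hag, hag i le_rfl, Function.update_self]
          omega
    have main : ∀ k i, i + k = m → ∀ c : ℤ,
        c₀ + EL w ρ i ≤ c → ∃ l, Wit M w p W l (ρ i) c := by
      intro k
      induction k with
      | zero =>
        intro i hi c hec
        obtain rfl : i = m := by omega
        exact ⟨0, .zero hm (key i c hec)⟩
      | succ k ih =>
        intro i hi c hec
        obtain ⟨l, hl⟩ := ih (i + 1) (by omega) (c + w (ρ i) (ρ (i + 1)))
          (by rw [EL_succ]; omega)
        exact ⟨l + 1, .succ (key i c hec) hl⟩
    rw [← h2]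
    exact main (m - n) n (by omega) c h3

theorem core_to_mdp [Fintype Q] [MeasurableSpace Q] [MeasurableSingletonClass Q]
    (M : MDP Q) (w : Q → Q → ℤ) (p : Q → ℕ)
    (hδP : ∀ q, q ∉ M.Q1 → ∀ x, M.E q x → M.δ q x = 1 / 2)
    (q₀ : Q) (c₀ : ℕ) (hcore : Core M w p q₀ c₀) :
    ∃ σ : Strategy M, ∃ μ : Measure (ℕ → Q), IsTrajMeasure M σ q₀ μ ∧
        μ (PosEnergy w c₀ ∩ Buchi {q | p q = 0}) = 1 := by
  obtain ⟨W, r, N, ch, h0, hchE, hW⟩ := hcore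
  let σ : Strategy M :=
    { act := fun h q => PMF.pure (ch q (c₀ + ELh w h q))
      act_support := by
        intro h q _ q' hq'
        rw [PMF.support_pure, Set.mem_singleton_iff] at hq'
        rw [hq']
        exact hchE _ _ }
  obtain ⟨μ, hμ⟩ := exists_traj M σ q₀
  have hprob : IsProbabilityMeasure μ := hμ.1
  refine ⟨σ, μ, hμ, ?_⟩
  have posW : ∀ f n, μ (cyl f n) ≠ 0 → W (f n) (c₀ + EL w f n) := by
    intro f n
    induction n with
    | zero =>
      intro h
      rw [cyl_zero hμ] at h
      have : f 0 = q₀ := by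
        by_contra hne
        exact h (if_neg hne)
      rw [this]
      simpa [EL] using h0
    | succ n ih =>
      intro h
      rw [cyl_succ hμ] at h
      have hWn := ih (left_ne_zero_of_mul h)
      have hst := right_ne_zero_of_mul h
      have hE := E_of_step hst
      rw [EL_succ, ← add_assoc]
      by_cases hq : f n ∈ M.Q1
      · rw [MDP.step, if_pos hq] at hst
        have hst' := (PMF.mem_support_iff _ _).2 hst
        simp only [σ, PMF.support_pure, Set.mem_singleton_iff, ELh_eq] at hst'
        rw [hst']
        exact (hW _ _ hWn).2.1
      · exact (hW _ _ hWn).2.2.2.1 hq _ hE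
  have half : ∀ f n, 1 / 2 ≤ M.step σ ((List.range n).map f) (f n)
      (ch (f n) (c₀ + EL w f n)) := by
    intro f n
    by_cases hq : f n ∈ M.Q1
    · rw [MDP.step, if_pos hq]
      simp only [σ, ELh_eq, PMF.pure_apply, if_true]
      simp
    · rw [MDP.step, if_neg hq, hδP _ hq _ (hchE _ _)]
  have lower : ∀ k f n, μ (cyl f n) ≠ 0 → r (f n) (c₀ + EL w f n) ≤ k →
      (1 / 2 : ℝ≥0∞) ^ k * μ (cyl f n) ≤
        μ (cyl f n ∩ {ρ | ∃ i, n ≤ i ∧ i ≤ n + k ∧ p (ρ i) = 0}) := by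
    intro k
    induction k with
    | zero =>
      intro f n hf hr
      have hp := (hW _ _ (posW f n hf)).2.2.1.resolve_right (by omega)
      rw [pow_zero, one_mul]
      refine measure_mono fun ρ hρ => ⟨hρ, n, le_rfl, le_rfl, ?_⟩
      rw [hρ n le_rfl]
      exact hp
    | succ k ih =>
      intro f n hf hr
      rcases (hW _ _ (posW f n hf)).2.2.1 with hp | hlt
      · calc (1 / 2 : ℝ≥0∞) ^ (k + 1) * μ (cyl f n) ≤ 1 * μ (cyl f n) := by
              gcongr
              exact pow_le_one₀ zero_le (by simp)
          _ ≤ _ := by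
              rw [one_mul]
              refine measure_mono fun ρ hρ => ⟨hρ, n, le_rfl, by omega, ?_⟩
              rw [hρ n le_rfl]
              exact hp
      · set s := ch (f n) (c₀ + EL w f n) with hs
        let g := Function.update f (n + 1) s
        have hag : ∀ j ≤ n, g j = f j := fun j hj => Function.update_of_ne (by omega) _ _
        have hgs : g (n + 1) = s := Function.update_self ..
        have hcg : μ (cyl g (n + 1)) =
            μ (cyl f n) * M.step σ ((List.range n).map f) (f n) s := by
          rw [cyl_succ hμ, cyl_congr hag, hag n le_rfl, hgs,
            map_range_congr (ρ' := f) fun i hi => hag i hi.le]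
        have hge : 1 / 2 * μ (cyl f n) ≤ μ (cyl g (n + 1)) := by
          rw [hcg, mul_comm]
          gcongr
          exact half f n
        have hg0 : μ (cyl g (n + 1)) ≠ 0 := by
          intro h
          rw [h] at hge
          have := le_antisymm hge zero_le
          rw [mul_eq_zero] at this
          rcases this with h' | h'
          · simp at h'
          · exact hf h'
        have hrg : r (g (n + 1)) (c₀ + EL w g (n + 1)) ≤ k := by
          rw [EL_succ, EL_congr w hag, hag n le_rfl, hgs, ← add_assoc]
          omega
        calc (1 / 2 : ℝ≥0∞) ^ (k + 1) * μ (cyl f n)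
            = (1 / 2) ^ k * (1 / 2 * μ (cyl f n)) := by rw [pow_succ, mul_assoc]
          _ ≤ (1 / 2) ^ k * μ (cyl g (n + 1)) := by gcongr
          _ ≤ _ := ih g (n + 1) hg0 hrg
          _ ≤ _ := by
            refine measure_mono ?_
            rintro ρ ⟨hρ, i, hi1, hi2, hi3⟩
            refine ⟨fun j hj => ?_, i, by omega, by omega, hi3⟩
            rw [hρ j (by omega), hag j hj]
  set ε : ℝ≥0∞ := (1 / 2) ^ N with hε
  have hε0 : ε ≠ 0 := pow_ne_zero _ (by simp)
  have hlt1 : 1 - ε < 1 := ENNReal.sub_lt_self ENNReal.one_ne_top one_ne_zero hε0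
  let D : ℕ → ℕ → Set (ℕ → Q) := fun m n => {ρ | ∀ i, m ≤ i → i < n → p (ρ i) ≠ 0}
  have hmeasE : ∀ n, MeasurableSet {ρ : ℕ → Q | ∃ i, n ≤ i ∧ i ≤ n + N ∧ p (ρ i) = 0} := by
    intro n
    have : {ρ : ℕ → Q | ∃ i, n ≤ i ∧ i ≤ n + N ∧ p (ρ i) = 0} =
        ⋃ i, ⋃ (_ : n ≤ i), ⋃ (_ : i ≤ n + N), (fun ρ : ℕ → Q => ρ i) ⁻¹' {q | p q = 0} := by
      ext ρ; simp only [Set.mem_iUnion, exists_prop]; rfl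
    rw [this]
    exact MeasurableSet.iUnion fun i => MeasurableSet.iUnion fun _ => MeasurableSet.iUnion fun _ =>
      (measurable_pi_apply i) (Set.toFinite _).measurableSet
  have contract : ∀ m n, m ≤ n → μ (D m (n + N + 1)) ≤ (1 - ε) * μ (D m n) := by
    intro m n hmn
    rw [sum_cyl μ q₀ n (D m (n + N + 1)), sum_cyl μ q₀ n (D m n), Finset.mul_sum]
    refine Finset.sum_le_sum fun x _ => ?_
    set f := extf q₀ n x
    by_cases hz : μ (cyl f n) = 0
    · rw [measure_mono_null Set.inter_subset_left hz]
      exact zero_le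
    by_cases hD : f ∈ D m n
    · have hsub : cyl f n ∩ D m n = cyl f n := by
        refine Set.inter_eq_left.2 fun ρ hρ i hi hin => ?_
        rw [hρ i hin.le]
        exact hD i hi hin
      rw [hsub]
      have hl := lower N f n hz (hW _ _ (posW f n hz)).2.2.2.2
      have hadd := measure_inter_add_sdiff (μ := μ) (cyl f n) (hmeasE n)
      calc μ (cyl f n ∩ D m (n + N + 1))
          ≤ μ (cyl f n \ {ρ | ∃ i, n ≤ i ∧ i ≤ n + N ∧ p (ρ i) = 0}) := by
            refine measure_mono ?_
            rintro ρ ⟨h1, h2⟩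
            refine ⟨h1, ?_⟩
            rintro ⟨i, hi1, hi2, hi3⟩
            exact h2 i (by omega) (by omega) hi3
        _ ≤ μ (cyl f n) - ε * μ (cyl f n) := by
            refine ENNReal.le_sub_of_add_le_right
              (ENNReal.mul_ne_top (by simp [hε]) (measure_ne_top _ _)) ?_
            exact (add_le_add_right hl _).trans (by rw [add_comm, hadd])
        _ = (1 - ε) * μ (cyl f n) := by
            rw [ENNReal.sub_mul (fun _ _ => measure_ne_top _ _), one_mul]
    · have : cyl f n ∩ D m (n + N + 1) = ∅ := by
        ext ρ
        simp only [Set.mem_inter_iff, Set.mem_empty_iff_false, iff_false, not_and]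
        intro h1 h2
        apply hD
        intro i hi hin
        rw [← h1 i hin.le]
        exact h2 i hi (by omega)
      rw [this, measure_empty]
      exact zero_le
  have hnull : ∀ m, μ {ρ | ∀ i, m ≤ i → p (ρ i) ≠ 0} = 0 := by
    intro m
    have hb : ∀ j : ℕ, μ {ρ | ∀ i, m ≤ i → p (ρ i) ≠ 0} ≤ (1 - ε) ^ j := by
      intro j
      have : μ (D m (m + j * (N + 1))) ≤ (1 - ε) ^ j := by
        induction j with
        | zero => simpa using prob_le_one
        | succ j ih =>
          have := contract m (m + j * (N + 1)) (by omega)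
          rw [show m + (j + 1) * (N + 1) = m + j * (N + 1) + N + 1 by ring, pow_succ']
          exact this.trans (mul_le_mul_right ih _)
      have hsub : {ρ : ℕ → Q | ∀ i, m ≤ i → p (ρ i) ≠ 0} ⊆ D m (m + j * (N + 1)) :=
        fun ρ hρ i hi _ => hρ i hi
      exact (measure_mono hsub).trans this
    have := ge_of_tendsto' (ENNReal.tendsto_pow_atTop_nhds_zero_of_lt_one hlt1) hb
    exact le_antisymm this zero_le
  have hae : ∀ᵐ ρ ∂μ, ρ ∈ PosEnergy w c₀ ∩ Buchi {q | p q = 0} := by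
    have hB : ∀ᵐ ρ ∂μ, ∀ m, ¬ ∀ i, m ≤ i → p (ρ i) ≠ 0 := by
      rw [ae_all_iff]
      intro m
      rw [ae_iff]
      simpa using hnull m
    filter_upwards [ae_pos μ q₀, hB] with ρ h1 h2
    refine ⟨fun n => (hW _ _ (posW ρ n (h1 n))).1, ?_⟩
    rw [mem_Buchi_iff]
    intro K
    have := h2 K
    push Not at this
    exact this
  have heq : (PosEnergy w c₀ ∩ Buchi {q | p q = 0} : Set (ℕ → Q)) =ᵐ[μ] Set.univ :=
    eventuallyEq_univ.2 hae
  rw [measure_congr heq, measure_univ]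

/-- Reduction of energy Büchi MDPs to energy Büchi games: in an MDP where every
probabilistic state has priority 1 and exactly two successors of probability 1/2 each,
player 1 wins the energy Büchi objective almost surely from `q₀` with credit `c₀` iff
player 1 wins the gadget game `G` surely from `q₀` for the energy Büchi objective with
credit `c₀`. (The unreachable gadget states attached to player-1 states of `Q`
carry a self-loop so that every state of the game has a successor.) -/
theorem energy_buchi_mdp_to_game [Fintype Q] [Nonempty Q]
    [MeasurableSpace Q] [MeasurableSingletonClass Q]
    (M : MDP Q) (w : Q → Q → ℤ) (p : Q → ℕ)
    (hp01 : ∀ q, p q ≤ 1)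
    (hpP : ∀ q, q ∉ M.Q1 → p q = 1)
    (hδP : ∀ q, q ∉ M.Q1 → ∃ a b : Q, a ≠ b ∧ (∀ x, M.E q x ↔ x = a ∨ x = b) ∧
      M.δ q a = 1 / 2 ∧ M.δ q b = 1 / 2)
    (G : Game (Q ⊕ Q × Bool))
    (hS1 : G.S1 = {s | (∃ q ∈ M.Q1, s = Sum.inl q) ∨
      (∃ q, q ∉ M.Q1 ∧ s = Sum.inr (q, false))})
    (hE : ∀ s s', G.E s s' ↔
      (match s, s' with
        | Sum.inl q, Sum.inl q' => q ∈ M.Q1 ∧ M.E q q'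
        | Sum.inl q, Sum.inr (q', _) => q ∉ M.Q1 ∧ q' = q
        | Sum.inr (q, _), Sum.inl q' => q ∉ M.Q1 ∧ M.E q q'
        | Sum.inr (q, d), Sum.inr (q', d') => q ∈ M.Q1 ∧ q' = q ∧ d' = d))
    (q₀ : Q) (c₀ : ℕ) :
    (∃ σ : Strategy M, ∃ μ : Measure (ℕ → Q), IsTrajMeasure M σ q₀ μ ∧
        μ (PosEnergy w c₀ ∩ Buchi {q | p q = 0}) = 1) ↔
      (∃ τ : GStrategy G, GWinning G τ (Sum.inl q₀)
        (PosEnergy (gadgetW w) c₀ ∩ Buchi {s | gadgetP p s = 0})) := by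
  have hG : IsGadget M G := by
    refine ⟨fun q => ?_, fun q => ?_, fun q => ?_, fun q q' => ?_, fun q q' d => ?_,
      fun q d q' => ?_, fun q d q' d' => ?_⟩
    · rw [hS1]
      simp
    · rw [hS1]
      simp
    · rw [hS1]
      simp
    · exact hE _ _
    · exact hE _ _
    · exact hE _ _
    · exact hE _ _
  have hδ : ∀ q, q ∉ M.Q1 → ∀ x, M.E q x → M.δ q x = 1 / 2 := by
    intro q hq x hx
    obtain ⟨a, b, -, hab, ha, hb⟩ := hδP q hq
    rcases (hab x).1 hx with rfl | rfl
    · exact ha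
    · exact hb
  constructor
  · rintro ⟨σ, μ, hμ, h1⟩
    exact core_to_game M w p hpP G hG q₀ c₀ (mdp_to_core M w p q₀ c₀ σ μ hμ h1)
  · intro h
    exact core_to_mdp M w p hδ q₀ c₀ (game_to_core M w p G hG q₀ c₀ h)

end MPP
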